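/- Let n ≥ 0 and let Γ be the n×n adjacency matrix over ZMod 2 of the path graph (Γ_{ij} = 1 iff |i−j| = 1). Let K_n be the number of pairs (S, v), where S ⊆ Fin n and v ∈ (ZMod 2)^n with v_i = 0 for all i ∈ S, such that the principal submatrix on the complement of S of the matrix obtained from Γ by replacing its diagonal with v is invertible over ZMod 2. Then (K_n : ℝ) = ((1+√3)^{n+1} − (1−√3)^{n+1}) / (2·√3). -/

import Mathlib

/-- The adjacency matrix of the path graph on `n` vertices over `ZMod 2`. -/
def pathAdj (n : ℕ) : Matrix (Fin n) (Fin n) (ZMod 2) :=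
  Matrix.of fun i j => if (i : ℕ) + 1 = (j : ℕ) ∨ (j : ℕ) + 1 = (i : ℕ) then 1 else 0

/-- The matrix `Γ` with its diagonal replaced by `v`. -/
def withDiag {k : ℕ} (Γ : Matrix (Fin k) (Fin k) (ZMod 2)) (v : Fin k → ZMod 2) :
    Matrix (Fin k) (Fin k) (ZMod 2) :=
  Matrix.of fun i j => if i = j then v i else Γ i j

/-- The principal submatrix of `Γ` obtained by deleting the rows and columns indexed by `S`,
i.e. the submatrix indexed by the complement of `S`. -/
def prinSub {k : ℕ} (Γ : Matrix (Fin k) (Fin k) (ZMod 2)) (S : Finset (Fin k)) :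
    Matrix {i // i ∈ Sᶜ} {i // i ∈ Sᶜ} (ZMod 2) :=
  Γ.submatrix Subtype.val Subtype.val

/-- The tridiagonal matrix encoded by a word; `none` means the vertex is deleted. -/
def triMat {n : ℕ} (c : Fin n → Option (ZMod 2)) : Matrix (Fin n) (Fin n) (ZMod 2) :=
  Matrix.of fun i j => if i = j then (c i).getD 1 else
    if ((i : ℕ) + 1 = (j : ℕ) ∨ (j : ℕ) + 1 = (i : ℕ)) ∧ (c i).isSome ∧ (c j).isSome then 1 else 0

lemma triMat_succ {n : ℕ} (x : Option (ZMod 2)) (c : Fin n → Option (ZMod 2)) :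
    (triMat (Fin.cons x c : Fin (n + 1) → Option (ZMod 2))).submatrix Fin.succ Fin.succ
      = triMat c := by
  ext i j
  simp [triMat]

lemma det_triMat_cons_cons {n : ℕ} (x y : Option (ZMod 2)) (c : Fin n → Option (ZMod 2)) :
    (triMat (Fin.cons x (Fin.cons y c : Fin (n + 1) → Option (ZMod 2)) :
        Fin (n + 2) → Option (ZMod 2))).det
      = x.getD 1 * (triMat (Fin.cons y c : Fin (n + 1) → Option (ZMod 2))).det
        + (if x.isSome ∧ y.isSome then (triMat c).det else 0) := by
  set M := triMat (Fin.cons x (Fin.cons y c : Fin (n + 1) → Option (ZMod 2)) :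
        Fin (n + 2) → Option (ZMod 2)) with hM
  have h00 : M 0 0 = x.getD 1 := by simp [hM, triMat]
  have h01 : M 0 1 = if x.isSome ∧ y.isSome then 1 else 0 := by
    have : (Fin.cons x (Fin.cons y c : Fin (n + 1) → Option (ZMod 2)) :
        Fin (n + 2) → Option (ZMod 2)) 1 = y := rfl
    simp [hM, triMat, this]
  have h10 : M 1 0 = if x.isSome ∧ y.isSome then 1 else 0 := by
    have : (Fin.cons x (Fin.cons y c : Fin (n + 1) → Option (ZMod 2)) :
        Fin (n + 2) → Option (ZMod 2)) 1 = y := rfl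
    simp [hM, triMat, this, and_comm]
  have h0 : ∀ j : Fin n, M 0 j.succ.succ = 0 := by
    intro j
    simp [hM, triMat, Fin.ext_iff]
  have h0' : ∀ j : Fin n, M j.succ.succ 0 = 0 := by
    intro j
    simp [hM, triMat, Fin.ext_iff]
  have hs : M.submatrix Fin.succ Fin.succ = triMat (Fin.cons y c : Fin (n + 1) → Option (ZMod 2)) :=
    triMat_succ _ _
  have hss : (M.submatrix Fin.succ (Fin.succAbove 1)).submatrix Fin.succ Fin.succ = triMat c := by
    rw [← triMat_succ y c, ← hs]
    ext i j
    simp [Fin.succAbove, Fin.lt_def]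
  have hminor : (M.submatrix Fin.succ (Fin.succAbove 1)).det
      = (if x.isSome ∧ y.isSome then 1 else 0) * (triMat c).det := by
    rw [Matrix.det_succ_column_zero, Fin.sum_univ_succ, Finset.sum_eq_zero]
    · simp only [Fin.succAbove_zero, hss]
      simp [h10]
    · intro i _
      have : M i.succ.succ (Fin.succAbove 1 0) = 0 := h0' i
      have this2 : M i.succ.succ 0 = 0 := h0' i
      simp [this2]
  rw [Matrix.det_succ_row_zero, Fin.sum_univ_succ, Fin.sum_univ_succ, Finset.sum_eq_zero]
  · have e : (Fin.succ 0 : Fin (n + 2)) = 1 := rfl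
    rw [e, Fin.succAbove_zero, hs, hminor, h00, h01]
    have : (-1 : ZMod 2) = 1 := by decide
    by_cases h : x.isSome ∧ y.isSome <;> simp [h, this]
  · intro i _
    simp [h0]

def ind (a : ZMod 2) : ℕ := if a = 0 then 0 else 1

def cnt (n : ℕ) : ℕ := ∑ c : Fin n → Option (ZMod 2), ind (triMat c).det

lemma sum_opt (f : Option (ZMod 2) → ℕ) : ∑ x, f x = f none + (f (some 0) + f (some 1)) := by
  rw [Fintype.sum_option]
  congr 1

lemma sum_cons {n : ℕ} (f : (Fin (n + 1) → Option (ZMod 2)) → ℕ) :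
    ∑ c, f c = ∑ c : Fin n → Option (ZMod 2), ∑ x, f (Fin.cons x c) := by
  rw [← (Fin.consEquiv (fun _ : Fin (n + 1) => Option (ZMod 2))).sum_comp,
    Fintype.sum_prod_type, Finset.sum_comm]
  rfl

lemma det_triMat_one (x : Option (ZMod 2)) (c : Fin 0 → Option (ZMod 2)) :
    (triMat (Fin.cons x c : Fin 1 → Option (ZMod 2))).det = x.getD 1 := by
  simp [triMat]

lemma det_none {n : ℕ} (c : Fin n → Option (ZMod 2)) :
    (triMat (Fin.cons none c : Fin (n + 1) → Option (ZMod 2))).det = (triMat c).det := by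
  cases n with
  | zero => rw [det_triMat_one]; simp
  | succ n =>
    rw [← Fin.cons_self_tail c, det_triMat_cons_cons]; simp

lemma det_one {n : ℕ} (c : Fin n → Option (ZMod 2)) :
    (triMat (Fin.cons (some 1) c : Fin (n + 1) → Option (ZMod 2))).det
      = (triMat (Fin.cons (some 0) c : Fin (n + 1) → Option (ZMod 2))).det + (triMat c).det := by
  cases n with
  | zero => rw [det_triMat_one, det_triMat_one]; simp
  | succ n =>
    rw [← Fin.cons_self_tail c, det_triMat_cons_cons, det_triMat_cons_cons]; simp [add_comm]

lemma cnt_rec (n : ℕ) : cnt (n + 2) = 2 * cnt (n + 1) + 2 * cnt n := by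
  unfold cnt
  rw [sum_cons, sum_cons, sum_cons, Finset.mul_sum, Finset.mul_sum, ← Finset.sum_add_distrib]
  refine Finset.sum_congr rfl fun c _ => ?_
  simp only [sum_opt, det_triMat_cons_cons, det_none, det_one]
  generalize (triMat c).det = p
  generalize (triMat (Fin.cons (some 0) c : Fin (n + 1) → Option (ZMod 2))).det = r
  revert p r
  simp only [Option.getD, Option.isSome]
  decide

lemma cnt_zero : cnt 0 = 1 := by
  simp [cnt, ind]

lemma cnt_one : cnt 1 = 2 := by
  unfold cnt
  rw [sum_cons]
  simp only [sum_opt, det_triMat_one, ind]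
  simp

lemma cnt_closed (n : ℕ) : (cnt n : ℝ)
    = ((1 + Real.sqrt 3) ^ (n + 1) - (1 - Real.sqrt 3) ^ (n + 1)) / (2 * Real.sqrt 3) := by
  have h3 : Real.sqrt 3 ^ 2 = 3 := Real.sq_sqrt (by norm_num)
  have hp : Real.sqrt 3 ≠ 0 := by positivity
  induction n using Nat.twoStepInduction with
  | zero => rw [cnt_zero]; field_simp; push_cast; ring
  | one => rw [cnt_one]; field_simp; push_cast; ring
  | more n h1 h2 =>
    rw [cnt_rec]; push_cast; rw [h1, h2]
    have a1 : (1 + Real.sqrt 3) ^ 2 = 2 * (1 + Real.sqrt 3) + 2 := by linear_combination h3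
    have a2 : (1 - Real.sqrt 3) ^ 2 = 2 * (1 - Real.sqrt 3) + 2 := by linear_combination h3
    field_simp
    linear_combination (-(1 + Real.sqrt 3) ^ (n + 1)) * a1 + ((1 - Real.sqrt 3) ^ (n + 1)) * a2

/-- Words correspond to pairs `(S, v)` with `v` vanishing on `S`. -/
def encode {n : ℕ} (p : Finset (Fin n) × (Fin n → ZMod 2)) : Fin n → Option (ZMod 2) :=
  fun i => if i ∈ p.1 then none else some (p.2 i)

lemma det_encode {n : ℕ} (p : Finset (Fin n) × (Fin n → ZMod 2)) :
    (triMat (encode p)).det = (prinSub (withDiag (pathAdj n) p.2) p.1).det := by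
  rw [Matrix.twoBlockTriangular_det (triMat (encode p)) (fun i => i ∈ p.1ᶜ)]
  · have h1 : Matrix.toSquareBlockProp (triMat (encode p)) (fun i => i ∈ p.1ᶜ)
        = prinSub (withDiag (pathAdj n) p.2) p.1 := by
      ext ⟨i, hi⟩ ⟨j, hj⟩
      rw [Finset.mem_compl] at hi hj
      simp [Matrix.toSquareBlockProp, triMat, encode, prinSub, withDiag, pathAdj, hi, hj]
    have h2 : Matrix.toSquareBlockProp (triMat (encode p)) (fun i => ¬ i ∈ p.1ᶜ) = 1 := by
      ext ⟨i, hi⟩ ⟨j, hj⟩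
      have hi' : i ∈ p.1 := by simpa using hi
      have hj' : j ∈ p.1 := by simpa using hj
      simp [Matrix.toSquareBlockProp, triMat, encode, Matrix.one_apply, hi', hj']
    rw [h1, h2, Matrix.det_one, mul_one]
    congr!
  · intro i hi j hj
    have hi' : i ∈ p.1 := by simpa using hi
    have hj' : j ∉ p.1 := by simpa using hj
    have : i ≠ j := by rintro rfl; exact hj' hi'
    simp [triMat, encode, hi', this]

def encEquiv (n : ℕ) : {p : Finset (Fin n) × (Fin n → ZMod 2) //
        (∀ i ∈ p.1, p.2 i = 0) ∧ IsUnit (prinSub (withDiag (pathAdj n) p.2) p.1)}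
      ≃ {c : Fin n → Option (ZMod 2) // (triMat c).det ≠ 0} where
  toFun p := ⟨encode p.1, by
    rw [det_encode]
    exact ((Matrix.isUnit_iff_isUnit_det _).1 p.2.2).ne_zero⟩
  invFun c := ⟨(Finset.univ.filter fun i => c.1 i = none, fun i => (c.1 i).getD 0), by
    refine ⟨fun i hi => ?_, ?_⟩
    · simp at hi
      simp [hi]
    · rw [Matrix.isUnit_iff_isUnit_det, ← det_encode, isUnit_iff_ne_zero]
      convert c.2 using 3
      ext1 i
      rcases h : c.1 i with _ | a <;> simp [encode, h]⟩
  left_inv p := by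
    obtain ⟨⟨S, v⟩, h1, h2⟩ := p
    apply Subtype.ext
    refine Prod.ext ?_ ?_
    · ext i
      simp [encode]
    · funext i
      by_cases hi : i ∈ S
      · have hv : v i = 0 := h1 i hi
        simp [encode, hi, hv]
      · simp [encode, hi]
  right_inv c := by
    apply Subtype.ext
    funext i
    rcases h : c.1 i with _ | a <;> simp [encode, h]

theorem stmt13 (n : ℕ) :
    (Nat.card {p : Finset (Fin n) × (Fin n → ZMod 2) //
        (∀ i ∈ p.1, p.2 i = 0) ∧ IsUnit (prinSub (withDiag (pathAdj n) p.2) p.1)} : ℝ)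
      = ((1 + Real.sqrt 3) ^ (n + 1) - (1 - Real.sqrt 3) ^ (n + 1)) / (2 * Real.sqrt 3) := by
  rw [← cnt_closed, Nat.card_congr (encEquiv n), Nat.card_eq_fintype_card, Fintype.card_subtype,
    Finset.card_filter]
  congr 1
  unfold cnt ind
  refine Finset.sum_congr rfl fun c _ => ?_
  by_cases h : (triMat c).det = 0 <;> simp [h]
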